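/- The maximum cardinality c'_{4,3} of a subset of [3]^4 containing no geometric line equals 43. -/

import Mathlib

/-- The cube `[3]^n = {1,2,3}^n`, viewed inside `ℤ^n`. -/
def cube (n : ℕ) : Finset (Fin n → ℤ) :=
  Fintype.piFinset fun _ => ({1, 2, 3} : Finset ℤ)

/-- A Moser set: a set containing no geometric line `{a, a+r, a+2r}` with `r ≠ 0`. -/
def MoserFree {n : ℕ} (A : Finset (Fin n → ℤ)) : Prop :=
  ¬ ∃ a r : Fin n → ℤ, r ≠ 0 ∧ a ∈ A ∧ a + r ∈ A ∧ a + r + r ∈ A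

/-! ### The three-dimensional inequality `3a + 4b + 5c + 12d ≤ 60` -/

/-- Best value on two opposite edges with availabilities `u`, `v`. -/
def halfB (d u v : Bool) : ℕ := if d then (u || v).toNat else u.toNat + v.toNat

/-- Upper bound for the number of chosen edge midpoints in one direction. -/
def maxB (d p q r s f g h k : Bool) : ℕ :=
  max (max (halfB d q s) (if p then 1 + halfB d (q && !f) (s && !k) else 0))
    (max (if r then 1 + halfB d (q && !g) (s && !h) else 0)
      (if p && r && !d then 2 + halfB d (q && !f && !g) (s && !k && !h) else 0))

theorem le_maxB : ∀ d p q r s f g h k x y z t : Bool,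
    (p && x) = false → (q && y) = false → (r && z) = false → (s && t) = false →
    (x && f && y) = false → (y && g && z) = false → (z && h && t) = false →
    (t && k && x) = false → (x && d && z) = false → (y && d && t) = false →
    x.toNat + y.toNat + z.toNat + t.toNat ≤ maxB d (!p) (!q) (!r) (!s) f g h k := by
  decide +kernel

set_option synthInstance.maxSize 4000 in
set_option synthInstance.maxHeartbeats 400000 in
theorem core3 :
    ∀ d : Bool,
    ∀ c122 : Bool,
    ∀ c322 : Bool,
    (c122 && d && c322) = false →
    ∀ c212 : Bool,
    ∀ c232 : Bool,
    (c212 && d && c232) = false →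
    ∀ c221 : Bool,
    ∀ c223 : Bool,
    (c221 && d && c223) = false →
    ∀ a111 : Bool,
    ∀ a113 : Bool,
    ∀ a131 : Bool,
    (a113 && c122 && a131) = false →
    ∀ a133 : Bool,
    (a111 && c122 && a133) = false →
    ∀ a311 : Bool,
    (a133 && d && a311) = false →
    (a113 && c212 && a311) = false →
    (a131 && c221 && a311) = false →
    ∀ a313 : Bool,
    (a131 && d && a313) = false →
    (a111 && c212 && a313) = false →
    (a133 && c223 && a313) = false →
    ∀ a331 : Bool,
    (a113 && d && a331) = false →
    (a313 && c322 && a331) = false →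
    (a133 && c232 && a331) = false →
    (a111 && c221 && a331) = false →
    ∀ a333 : Bool,
    (a111 && d && a333) = false →
    (a311 && c322 && a333) = false →
    (a131 && c232 && a333) = false →
    (a113 && c223 && a333) = false →
    3 * (a111.toNat + a113.toNat + a131.toNat + a133.toNat + a311.toNat + a313.toNat + a331.toNat + a333.toNat) +
    5 * (c122.toNat + c322.toNat + c212.toNat + c232.toNat + c221.toNat + c223.toNat) + 12 * d.toNat +
    4 * (maxB d (!(a111 && a311)) (!(a113 && a313)) (!(a133 && a333)) (!(a131 && a331)) c212 c223 c232 c221 +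
      maxB d (!(a111 && a131)) (!(a113 && a133)) (!(a313 && a333)) (!(a311 && a331)) c122 c223 c322 c221 +
      maxB d (!(a111 && a113)) (!(a131 && a133)) (!(a331 && a333)) (!(a311 && a313)) c122 c232 c322 c212) ≤ 60 := by
  decide +kernel

/-- The weight of a set in the three-dimensional cube. -/
def weight3 (g : ℤ → ℤ → ℤ → Bool) : ℕ :=
  3 * ((g 1 1 1).toNat +
      (g 1 1 3).toNat +
      (g 1 3 1).toNat +
      (g 1 3 3).toNat +
      (g 3 1 1).toNat +
      (g 3 1 3).toNat +
      (g 3 3 1).toNat +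
      (g 3 3 3).toNat) +
  5 * ((g 1 2 2).toNat +
      (g 3 2 2).toNat +
      (g 2 1 2).toNat +
      (g 2 3 2).toNat +
      (g 2 2 1).toNat +
      (g 2 2 3).toNat) + 12 * (g 2 2 2).toNat +
  4 * (((g 2 1 1).toNat +
      (g 2 1 3).toNat +
      (g 2 3 3).toNat +
      (g 2 3 1).toNat) + ((g 1 2 1).toNat +
      (g 1 2 3).toNat +
      (g 3 2 3).toNat +
      (g 3 2 1).toNat) + ((g 1 1 2).toNat +
      (g 1 3 2).toNat +
      (g 3 3 2).toNat +
      (g 3 1 2).toNat))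

/-- No geometric line, in coordinates. -/
def NoLine3 (g : ℤ → ℤ → ℤ → Bool) : Prop := ∀ a b c r s t : ℤ,
  (r ≠ 0 ∨ s ≠ 0 ∨ t ≠ 0) →
    (g a b c && g (a + r) (b + s) (c + t) && g (a + r + r) (b + s + s) (c + t + t)) = false

theorem NoLine3.mid {g : ℤ → ℤ → ℤ → Bool} (hg : NoLine3 g) (a b c a' b' c' a'' b'' c'' : ℤ)
    (hne : a ≠ a' ∨ b ≠ b' ∨ c ≠ c') (h : a + a'' = 2 * a' ∧ b + b'' = 2 * b' ∧ c + c'' = 2 * c') :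
    (g a b c && g a' b' c' && g a'' b'' c'') = false := by
  have := hg a b c (a' - a) (b' - b) (c' - c) (by omega)
  convert this using 3 <;> (congr 1 <;> omega)

theorem weight3_le {g : ℤ → ℤ → ℤ → Bool} (hg : NoLine3 g) : weight3 g ≤ 60 := by
  have key := core3
    (g 2 2 2)
    (g 1 2 2)
    (g 3 2 2)
    (hg.mid 1 2 2 2 2 2 3 2 2 (by decide) (by decide))
    (g 2 1 2)
    (g 2 3 2)
    (hg.mid 2 1 2 2 2 2 2 3 2 (by decide) (by decide))
    (g 2 2 1)
    (g 2 2 3)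
    (hg.mid 2 2 1 2 2 2 2 2 3 (by decide) (by decide))
    (g 1 1 1)
    (g 1 1 3)
    (g 1 3 1)
    (hg.mid 1 1 3 1 2 2 1 3 1 (by decide) (by decide))
    (g 1 3 3)
    (hg.mid 1 1 1 1 2 2 1 3 3 (by decide) (by decide))
    (g 3 1 1)
    (hg.mid 1 3 3 2 2 2 3 1 1 (by decide) (by decide))
    (hg.mid 1 1 3 2 1 2 3 1 1 (by decide) (by decide))
    (hg.mid 1 3 1 2 2 1 3 1 1 (by decide) (by decide))
    (g 3 1 3)
    (hg.mid 1 3 1 2 2 2 3 1 3 (by decide) (by decide))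
    (hg.mid 1 1 1 2 1 2 3 1 3 (by decide) (by decide))
    (hg.mid 1 3 3 2 2 3 3 1 3 (by decide) (by decide))
    (g 3 3 1)
    (hg.mid 1 1 3 2 2 2 3 3 1 (by decide) (by decide))
    (hg.mid 3 1 3 3 2 2 3 3 1 (by decide) (by decide))
    (hg.mid 1 3 3 2 3 2 3 3 1 (by decide) (by decide))
    (hg.mid 1 1 1 2 2 1 3 3 1 (by decide) (by decide))
    (g 3 3 3)
    (hg.mid 1 1 1 2 2 2 3 3 3 (by decide) (by decide))
    (hg.mid 3 1 1 3 2 2 3 3 3 (by decide) (by decide))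
    (hg.mid 1 3 1 2 3 2 3 3 3 (by decide) (by decide))
    (hg.mid 1 1 3 2 2 3 3 3 3 (by decide) (by decide))
  have h0 := le_maxB (g 2 2 2)
    ((g 1 1 1) && (g 3 1 1))
    ((g 1 1 3) && (g 3 1 3))
    ((g 1 3 3) && (g 3 3 3))
    ((g 1 3 1) && (g 3 3 1))
    (g 2 1 2) (g 2 2 3) (g 2 3 2) (g 2 2 1)
    (g 2 1 1) (g 2 1 3) (g 2 3 3) (g 2 3 1)
    (by have := (hg.mid 1 1 1 2 1 1 3 1 1 (by decide) (by decide)); revert this; cases (g 1 1 1) <;> cases (g 3 1 1) <;> simp)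
    (by have := (hg.mid 1 1 3 2 1 3 3 1 3 (by decide) (by decide)); revert this; cases (g 1 1 3) <;> cases (g 3 1 3) <;> simp)
    (by have := (hg.mid 1 3 3 2 3 3 3 3 3 (by decide) (by decide)); revert this; cases (g 1 3 3) <;> cases (g 3 3 3) <;> simp)
    (by have := (hg.mid 1 3 1 2 3 1 3 3 1 (by decide) (by decide)); revert this; cases (g 1 3 1) <;> cases (g 3 3 1) <;> simp)
    (hg.mid 2 1 1 2 1 2 2 1 3 (by decide) (by decide))
    (hg.mid 2 1 3 2 2 3 2 3 3 (by decide) (by decide))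
    (hg.mid 2 3 3 2 3 2 2 3 1 (by decide) (by decide))
    (hg.mid 2 3 1 2 2 1 2 1 1 (by decide) (by decide))
    (hg.mid 2 1 1 2 2 2 2 3 3 (by decide) (by decide))
    (hg.mid 2 1 3 2 2 2 2 3 1 (by decide) (by decide))
  have h1 := le_maxB (g 2 2 2)
    ((g 1 1 1) && (g 1 3 1))
    ((g 1 1 3) && (g 1 3 3))
    ((g 3 1 3) && (g 3 3 3))
    ((g 3 1 1) && (g 3 3 1))
    (g 1 2 2) (g 2 2 3) (g 3 2 2) (g 2 2 1)
    (g 1 2 1) (g 1 2 3) (g 3 2 3) (g 3 2 1)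
    (by have := (hg.mid 1 1 1 1 2 1 1 3 1 (by decide) (by decide)); revert this; cases (g 1 1 1) <;> cases (g 1 3 1) <;> simp)
    (by have := (hg.mid 1 1 3 1 2 3 1 3 3 (by decide) (by decide)); revert this; cases (g 1 1 3) <;> cases (g 1 3 3) <;> simp)
    (by have := (hg.mid 3 1 3 3 2 3 3 3 3 (by decide) (by decide)); revert this; cases (g 3 1 3) <;> cases (g 3 3 3) <;> simp)
    (by have := (hg.mid 3 1 1 3 2 1 3 3 1 (by decide) (by decide)); revert this; cases (g 3 1 1) <;> cases (g 3 3 1) <;> simp)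
    (hg.mid 1 2 1 1 2 2 1 2 3 (by decide) (by decide))
    (hg.mid 1 2 3 2 2 3 3 2 3 (by decide) (by decide))
    (hg.mid 3 2 3 3 2 2 3 2 1 (by decide) (by decide))
    (hg.mid 3 2 1 2 2 1 1 2 1 (by decide) (by decide))
    (hg.mid 1 2 1 2 2 2 3 2 3 (by decide) (by decide))
    (hg.mid 1 2 3 2 2 2 3 2 1 (by decide) (by decide))
  have h2 := le_maxB (g 2 2 2)
    ((g 1 1 1) && (g 1 1 3))
    ((g 1 3 1) && (g 1 3 3))
    ((g 3 3 1) && (g 3 3 3))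
    ((g 3 1 1) && (g 3 1 3))
    (g 1 2 2) (g 2 3 2) (g 3 2 2) (g 2 1 2)
    (g 1 1 2) (g 1 3 2) (g 3 3 2) (g 3 1 2)
    (by have := (hg.mid 1 1 1 1 1 2 1 1 3 (by decide) (by decide)); revert this; cases (g 1 1 1) <;> cases (g 1 1 3) <;> simp)
    (by have := (hg.mid 1 3 1 1 3 2 1 3 3 (by decide) (by decide)); revert this; cases (g 1 3 1) <;> cases (g 1 3 3) <;> simp)
    (by have := (hg.mid 3 3 1 3 3 2 3 3 3 (by decide) (by decide)); revert this; cases (g 3 3 1) <;> cases (g 3 3 3) <;> simp)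
    (by have := (hg.mid 3 1 1 3 1 2 3 1 3 (by decide) (by decide)); revert this; cases (g 3 1 1) <;> cases (g 3 1 3) <;> simp)
    (hg.mid 1 1 2 1 2 2 1 3 2 (by decide) (by decide))
    (hg.mid 1 3 2 2 3 2 3 3 2 (by decide) (by decide))
    (hg.mid 3 3 2 3 2 2 3 1 2 (by decide) (by decide))
    (hg.mid 3 1 2 2 1 2 1 1 2 (by decide) (by decide))
    (hg.mid 1 1 2 2 2 2 3 3 2 (by decide) (by decide))
    (hg.mid 1 3 2 2 2 2 3 1 2 (by decide) (by decide))
  unfold weight3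
  omega
/-! ### The four-dimensional case -/

/-- No geometric line, in coordinates. -/
def NoLine4 (F : ℤ → ℤ → ℤ → ℤ → Bool) : Prop := ∀ a b c d a' b' c' d' a'' b'' c'' d'' : ℤ,
  (a ≠ a' ∨ b ≠ b' ∨ c ≠ c' ∨ d ≠ d') →
  (a + a'' = 2 * a' ∧ b + b'' = 2 * b' ∧ c + c'' = 2 * c' ∧ d + d'' = 2 * d') →
    (F a b c d && F a' b' c' d' && F a'' b'' c'' d'') = false

theorem NoLine4.slice {F : ℤ → ℤ → ℤ → ℤ → Bool} (hF : NoLine4 F) (x : ℤ) :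
    NoLine3 (F x) := by
  intro a b c r s t h
  exact hF _ _ _ _ _ _ _ _ _ _ _ _ (by omega) (by omega)

theorem NoLine4.swap1 {F : ℤ → ℤ → ℤ → ℤ → Bool} (hF : NoLine4 F) :
    NoLine4 (fun x y z t => F y x z t) := by
  intro a b c d a' b' c' d' a'' b'' c'' d'' h h'
  exact hF _ _ _ _ _ _ _ _ _ _ _ _ (by omega) (by omega)

theorem NoLine4.swap2 {F : ℤ → ℤ → ℤ → ℤ → Bool} (hF : NoLine4 F) :
    NoLine4 (fun x y z t => F y z x t) := by
  intro a b c d a' b' c' d' a'' b'' c'' d'' h h'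
  exact hF _ _ _ _ _ _ _ _ _ _ _ _ (by omega) (by omega)

theorem NoLine4.swap3 {F : ℤ → ℤ → ℤ → ℤ → Bool} (hF : NoLine4 F) :
    NoLine4 (fun x y z t => F y z t x) := by
  intro a b c d a' b' c' d' a'' b'' c'' d'' h h'
  exact hF _ _ _ _ _ _ _ _ _ _ _ _ (by omega) (by omega)

theorem drop_mid {x y z : Bool} (hy : y = true) (h : (x && y && z) = false) :
    (x && z) = false := by
  subst hy; revert h; cases x <;> cases z <;> simp

theorem drop_ends {x y z : Bool} (hx : x = true) (hz : z = true) (h : (x && y && z) = false) :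
    y.toNat = 0 := by
  subst hx hz; revert h; cases y <;> simp

theorem sum_le_two {x y z : Bool} (h : (x && y && z) = false) :
    x.toNat + z.toNat + y.toNat ≤ 2 := by
  revert h; cases x <;> cases y <;> cases z <;> simp

theorem eq_true_of_pos {x : Bool} (h : 1 ≤ x.toNat) : x = true := by
  revert h; cases x <;> simp

set_option synthInstance.maxSize 4000 in
set_option synthInstance.maxHeartbeats 400000 in
theorem mid8 : ∀ b111 b113 b131 b133 b311 b313 b331 b333 k0 k1 k2 k3 : Bool,
    (k0 && b111) = false → (k0 && b333) = false → (k1 && b113) = false →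
    (k1 && b331) = false → (k2 && b131) = false → (k2 && b313) = false →
    (k3 && b133) = false → (k3 && b311) = false → (b111 && b113) = false →
    (b111 && b131) = false → (b111 && b311) = false → (b113 && b133) = false →
    (b113 && b313) = false → (b131 && b133) = false → (b131 && b331) = false →
    (b133 && b333) = false → (b311 && b313) = false → (b311 && b331) = false →
    (b313 && b333) = false → (b331 && b333) = false →
    b111.toNat + b113.toNat + b131.toNat + b133.toNat + b311.toNat +
      b313.toNat + b331.toNat + b333.toNat +
      (k0 || k1 || k2 || k3).toNat ≤ 4 := by
  decide +kernel

/-- Number of chosen points with only the first coordinate equal to two. -/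
def edgeSum (F : ℤ → ℤ → ℤ → ℤ → Bool) : ℕ :=
  (F 2 1 1 1).toNat + (F 2 1 1 3).toNat + (F 2 1 3 1).toNat + (F 2 1 3 3).toNat + (F 2 3 1 1).toNat +
  (F 2 3 1 3).toNat + (F 2 3 3 1).toNat + (F 2 3 3 3).toNat

/-- Whether two opposite edges in the first direction are blocked. -/
def blocked (F : ℤ → ℤ → ℤ → ℤ → Bool) : Bool :=
  ((F 1 1 1 1) && (F 3 1 1 1) && (F 1 3 3 3) && (F 3 3 3 3)) ||
  ((F 1 1 1 3) && (F 3 1 1 3) && (F 1 3 3 1) && (F 3 3 3 1)) ||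
  ((F 1 1 3 1) && (F 3 1 3 1) && (F 1 3 1 3) && (F 3 3 1 3)) ||
  ((F 1 1 3 3) && (F 3 1 3 3) && (F 1 3 1 1) && (F 3 3 1 1))

theorem block_left {x y z u v : Bool} (h : (x && y && z) = false) :
    ((x && z && u && v) && y) = false := by
  revert h; cases x <;> cases y <;> cases z <;> simp

theorem block_right {x y z u v : Bool} (h : (x && y && z) = false) :
    ((u && v && z && x) && y) = false := by
  revert h; cases x <;> cases y <;> cases z <;> simp

theorem edgeSum_le {F : ℤ → ℤ → ℤ → ℤ → Bool} (hF : NoLine4 F)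
    (hc : ∀ y z : ℤ, (y = 1 ∨ y = 3) → (z = 1 ∨ z = 3) →
      F 2 2 y z = true ∧ F 2 y 2 z = true ∧ F 2 y z 2 = true) :
    edgeSum F + (blocked F).toNat ≤ 4 := by
  refine mid8 (F 2 1 1 1) (F 2 1 1 3) (F 2 1 3 1) (F 2 1 3 3) (F 2 3 1 1)
    (F 2 3 1 3) (F 2 3 3 1) (F 2 3 3 3)
    ((F 1 1 1 1) && (F 3 1 1 1) && (F 1 3 3 3) && (F 3 3 3 3))
    ((F 1 1 1 3) && (F 3 1 1 3) && (F 1 3 3 1) && (F 3 3 3 1))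
    ((F 1 1 3 1) && (F 3 1 3 1) && (F 1 3 1 3) && (F 3 3 1 3))
    ((F 1 1 3 3) && (F 3 1 3 3) && (F 1 3 1 1) && (F 3 3 1 1))
    (block_left (hF 1 1 1 1 2 1 1 1 3 1 1 1 (by decide) (by decide)))
    (block_right (hF 3 3 3 3 2 3 3 3 1 3 3 3 (by decide) (by decide)))
    (block_left (hF 1 1 1 3 2 1 1 3 3 1 1 3 (by decide) (by decide)))
    (block_right (hF 3 3 3 1 2 3 3 1 1 3 3 1 (by decide) (by decide)))
    (block_left (hF 1 1 3 1 2 1 3 1 3 1 3 1 (by decide) (by decide)))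
    (block_right (hF 3 3 1 3 2 3 1 3 1 3 1 3 (by decide) (by decide)))
    (block_left (hF 1 1 3 3 2 1 3 3 3 1 3 3 (by decide) (by decide)))
    (block_right (hF 3 3 1 1 2 3 1 1 1 3 1 1 (by decide) (by decide)))
    (drop_mid (hc 1 1 (by decide) (by decide)).2.2
      (hF 2 1 1 1 2 1 1 2 2 1 1 3 (by decide) (by decide)))
    (drop_mid (hc 1 1 (by decide) (by decide)).2.1
      (hF 2 1 1 1 2 1 2 1 2 1 3 1 (by decide) (by decide)))
    (drop_mid (hc 1 1 (by decide) (by decide)).1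
      (hF 2 1 1 1 2 2 1 1 2 3 1 1 (by decide) (by decide)))
    (drop_mid (hc 1 3 (by decide) (by decide)).2.1
      (hF 2 1 1 3 2 1 2 3 2 1 3 3 (by decide) (by decide)))
    (drop_mid (hc 1 3 (by decide) (by decide)).1
      (hF 2 1 1 3 2 2 1 3 2 3 1 3 (by decide) (by decide)))
    (drop_mid (hc 1 3 (by decide) (by decide)).2.2
      (hF 2 1 3 1 2 1 3 2 2 1 3 3 (by decide) (by decide)))
    (drop_mid (hc 3 1 (by decide) (by decide)).1
      (hF 2 1 3 1 2 2 3 1 2 3 3 1 (by decide) (by decide)))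
    (drop_mid (hc 3 3 (by decide) (by decide)).1
      (hF 2 1 3 3 2 2 3 3 2 3 3 3 (by decide) (by decide)))
    (drop_mid (hc 3 1 (by decide) (by decide)).2.2
      (hF 2 3 1 1 2 3 1 2 2 3 1 3 (by decide) (by decide)))
    (drop_mid (hc 3 1 (by decide) (by decide)).2.1
      (hF 2 3 1 1 2 3 2 1 2 3 3 1 (by decide) (by decide)))
    (drop_mid (hc 3 3 (by decide) (by decide)).2.1
      (hF 2 3 1 3 2 3 2 3 2 3 3 3 (by decide) (by decide)))
    (drop_mid (hc 3 3 (by decide) (by decide)).2.2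
      (hF 2 3 3 1 2 3 3 2 2 3 3 3 (by decide) (by decide)))

set_option synthInstance.maxSize 4000 in
set_option synthInstance.maxHeartbeats 400000 in
theorem coreA :
    ∀ a1111 : Bool,
    ∀ a1113 : Bool,
    ∀ a1131 : Bool, (a1113 && a1131) = false →
    ∀ a1133 : Bool, (a1111 && a1133) = false →
    ∀ a1311 : Bool, (a1113 && a1311) = false → (a1131 && a1311) = false →
    ∀ a1313 : Bool, (a1111 && a1313) = false → (a1133 && a1313) = false →
    ∀ a1331 : Bool, (a1111 && a1331) = false → (a1133 && a1331) = false → (a1313 && a1331) = false →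
    ∀ a1333 : Bool, (a1113 && a1333) = false → (a1131 && a1333) = false → (a1311 && a1333) = false →
    ∀ a3111 : Bool, (a1113 && a3111) = false → (a1131 && a3111) = false → (a1311 && a3111) = false →
    ∀ a3113 : Bool, (a1111 && a3113) = false → (a1133 && a3113) = false → (a1313 && a3113) = false →
    ∀ a3131 : Bool, (a1111 && a3131) = false → (a1133 && a3131) = false → (a1331 && a3131) = false → (a3113 && a3131) = false →
    ∀ a3133 : Bool, (a1113 && a3133) = false → (a1131 && a3133) = false → (a1333 && a3133) = false → (a3111 && a3133) = false →
    ∀ a3311 : Bool, (a1111 && a3311) = false → (a1313 && a3311) = false → (a1331 && a3311) = false → (a3113 && a3311) = false → (a3131 && a3311) = false →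
    ∀ a3313 : Bool, (a1113 && a3313) = false → (a1311 && a3313) = false → (a1333 && a3313) = false → (a3111 && a3313) = false → (a3133 && a3313) = false →
    ∀ a3331 : Bool, (a1131 && a3331) = false → (a1311 && a3331) = false → (a1333 && a3331) = false → (a3111 && a3331) = false → (a3133 && a3331) = false → (a3313 && a3331) = false →
    ∀ a3333 : Bool, (a1133 && a3333) = false → (a1313 && a3333) = false → (a1331 && a3333) = false → (a3113 && a3333) = false → (a3131 && a3333) = false → (a3311 && a3333) = false →
    a1111.toNat + a1113.toNat + a1131.toNat + a1133.toNat + a1311.toNat +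
      a1313.toNat + a1331.toNat + a1333.toNat + a3111.toNat + a3113.toNat +
      a3131.toNat + a3133.toNat + a3311.toNat + a3313.toNat + a3331.toNat +
      a3333.toNat ≤
    3 + ((a1111 && a3111 && a1333 && a3333) ||
      (a1113 && a3113 && a1331 && a3331) ||
      (a1131 && a3131 && a1313 && a3313) ||
      (a1133 && a3133 && a1311 && a3311)).toNat +
    ((a1111 && a1311 && a3133 && a3333) ||
      (a1113 && a1313 && a3131 && a3331) ||
      (a1131 && a1331 && a3113 && a3313) ||
      (a1133 && a1333 && a3111 && a3311)).toNat +
    ((a1111 && a1131 && a3313 && a3333) ||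
      (a1113 && a1133 && a3311 && a3331) ||
      (a1311 && a1331 && a3113 && a3133) ||
      (a1313 && a1333 && a3111 && a3131)).toNat +
    ((a1111 && a1113 && a3331 && a3333) ||
      (a1131 && a1133 && a3311 && a3313) ||
      (a1311 && a1313 && a3131 && a3133) ||
      (a1331 && a1333 && a3111 && a3113)).toNat := by
  decide +kernel

theorem upper4 {F : ℤ → ℤ → ℤ → ℤ → Bool} (hF : NoLine4 F) :
    ∑ a ∈ ({1, 2, 3} : Finset ℤ), ∑ b ∈ ({1, 2, 3} : Finset ℤ), ∑ c ∈ ({1, 2, 3} : Finset ℤ),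
      ∑ d ∈ ({1, 2, 3} : Finset ℤ), (F a b c d).toNat ≤ 43 := by
  have hsum : weight3 (F 1) + weight3 (F 3) +
      weight3 (fun y z t => F y 1 z t) + weight3 (fun y z t => F y 3 z t) +
      weight3 (fun y z t => F y z 1 t) + weight3 (fun y z t => F y z 3 t) +
      weight3 (fun y z t => F y z t 1) + weight3 (fun y z t => F y z t 3) ≤ 480 := by
    have h1 := weight3_le (hF.slice 1)
    have h2 := weight3_le (hF.slice 3)
    have h3 := weight3_le (hF.swap1.slice 1)
    have h4 := weight3_le (hF.swap1.slice 3)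
    have h5 := weight3_le (hF.swap2.slice 1)
    have h6 := weight3_le (hF.swap2.slice 3)
    have h7 := weight3_le (hF.swap3.slice 1)
    have h8 := weight3_le (hF.swap3.slice 3)
    omega
  obtain ⟨s0, hs0⟩ : ∃ s, s =
      (F 1 1 1 1).toNat + (F 1 1 1 3).toNat + (F 1 1 3 1).toNat + (F 1 1 3 3).toNat + (F 1 3 1 1).toNat +
      (F 1 3 1 3).toNat + (F 1 3 3 1).toNat + (F 1 3 3 3).toNat + (F 3 1 1 1).toNat + (F 3 1 1 3).toNat +
      (F 3 1 3 1).toNat + (F 3 1 3 3).toNat + (F 3 3 1 1).toNat + (F 3 3 1 3).toNat + (F 3 3 3 1).toNat +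
      (F 3 3 3 3).toNat := ⟨_, rfl⟩
  obtain ⟨s1, hs1⟩ : ∃ s, s =
      (F 1 1 1 2).toNat + (F 1 1 2 1).toNat + (F 1 1 2 3).toNat + (F 1 1 3 2).toNat + (F 1 2 1 1).toNat +
      (F 1 2 1 3).toNat + (F 1 2 3 1).toNat + (F 1 2 3 3).toNat + (F 1 3 1 2).toNat + (F 1 3 2 1).toNat +
      (F 1 3 2 3).toNat + (F 1 3 3 2).toNat + (F 2 1 1 1).toNat + (F 2 1 1 3).toNat + (F 2 1 3 1).toNat +
      (F 2 1 3 3).toNat + (F 2 3 1 1).toNat + (F 2 3 1 3).toNat + (F 2 3 3 1).toNat + (F 2 3 3 3).toNat +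
      (F 3 1 1 2).toNat + (F 3 1 2 1).toNat + (F 3 1 2 3).toNat + (F 3 1 3 2).toNat + (F 3 2 1 1).toNat +
      (F 3 2 1 3).toNat + (F 3 2 3 1).toNat + (F 3 2 3 3).toNat + (F 3 3 1 2).toNat + (F 3 3 2 1).toNat +
      (F 3 3 2 3).toNat + (F 3 3 3 2).toNat := ⟨_, rfl⟩
  obtain ⟨s2, hs2⟩ : ∃ s, s =
      (F 1 1 2 2).toNat + (F 1 2 1 2).toNat + (F 1 2 2 1).toNat + (F 1 2 2 3).toNat + (F 1 2 3 2).toNat +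
      (F 1 3 2 2).toNat + (F 2 1 1 2).toNat + (F 2 1 2 1).toNat + (F 2 1 2 3).toNat + (F 2 1 3 2).toNat +
      (F 2 2 1 1).toNat + (F 2 2 1 3).toNat + (F 2 2 3 1).toNat + (F 2 2 3 3).toNat + (F 2 3 1 2).toNat +
      (F 2 3 2 1).toNat + (F 2 3 2 3).toNat + (F 2 3 3 2).toNat + (F 3 1 2 2).toNat + (F 3 2 1 2).toNat +
      (F 3 2 2 1).toNat + (F 3 2 2 3).toNat + (F 3 2 3 2).toNat + (F 3 3 2 2).toNat := ⟨_, rfl⟩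
  obtain ⟨s3, hs3⟩ : ∃ s, s =
      (F 1 2 2 2).toNat + (F 2 1 2 2).toNat + (F 2 2 1 2).toNat + (F 2 2 2 1).toNat + (F 2 2 2 3).toNat +
      (F 2 2 3 2).toNat + (F 2 3 2 2).toNat + (F 3 2 2 2).toNat := ⟨_, rfl⟩
  have hT : ∑ a ∈ ({1, 2, 3} : Finset ℤ), ∑ b ∈ ({1, 2, 3} : Finset ℤ),
      ∑ c ∈ ({1, 2, 3} : Finset ℤ), ∑ d ∈ ({1, 2, 3} : Finset ℤ), (F a b c d).toNat =
      s0 + s1 + s2 + s3 + (F 2 2 2 2).toNat := by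
    have expand : ∀ f : ℤ → ℕ, ∑ x ∈ ({1, 2, 3} : Finset ℤ), f x = f 1 + f 2 + f 3 := by
      intro f
      rw [Finset.sum_insert (by decide), Finset.sum_insert (by decide), Finset.sum_singleton]
      ring
    simp only [expand]
    clear hsum
    omega
  have hw : 12 * s0 + 12 * s1 + 10 * s2 + 12 * s3 ≤ 480 := by
    clear hT
    simp only [weight3] at hsum
    omega
  rw [hT]
  clear hT hsum
  by_contra hlt
  have he : (F 2 2 2 2).toNat ≤ 1 := Bool.toNat_le _
  have hanti : s2 + 12 * (F 2 2 2 2).toNat ≤ 24 := by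
    have h0 := sum_le_two (hF 1 1 2 2 2 2 2 2 3 3 2 2 (by decide) (by decide))
    have h1 := sum_le_two (hF 1 2 1 2 2 2 2 2 3 2 3 2 (by decide) (by decide))
    have h2 := sum_le_two (hF 1 2 2 1 2 2 2 2 3 2 2 3 (by decide) (by decide))
    have h3 := sum_le_two (hF 1 2 2 3 2 2 2 2 3 2 2 1 (by decide) (by decide))
    have h4 := sum_le_two (hF 1 2 3 2 2 2 2 2 3 2 1 2 (by decide) (by decide))
    have h5 := sum_le_two (hF 1 3 2 2 2 2 2 2 3 1 2 2 (by decide) (by decide))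
    have h6 := sum_le_two (hF 2 1 1 2 2 2 2 2 2 3 3 2 (by decide) (by decide))
    have h7 := sum_le_two (hF 2 1 2 1 2 2 2 2 2 3 2 3 (by decide) (by decide))
    have h8 := sum_le_two (hF 2 1 2 3 2 2 2 2 2 3 2 1 (by decide) (by decide))
    have h9 := sum_le_two (hF 2 1 3 2 2 2 2 2 2 3 1 2 (by decide) (by decide))
    have h10 := sum_le_two (hF 2 2 1 1 2 2 2 2 2 2 3 3 (by decide) (by decide))
    have h11 := sum_le_two (hF 2 2 1 3 2 2 2 2 2 2 3 1 (by decide) (by decide))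
    clear hs0 hs1 hs3
    omega
  have he0 : (F 2 2 2 2).toNat = 0 := by clear hs0 hs1 hs2 hs3; omega
  have hs2ge : 24 ≤ s2 := by clear hs0 hs1 hs2 hs3; omega
  have hsab : 20 ≤ s0 + s1 + s3 := by clear hs0 hs1 hs2 hs3; omega
  have hle : ∀ a b c d, (F a b c d).toNat ≤ 1 := fun a b c d => Bool.toNat_le _
  clear hw hlt hanti he he0
  have hC : (F 1 1 2 2) = true ∧ (F 1 2 1 2) = true ∧ (F 1 2 2 1) = true ∧ (F 1 2 2 3) = true ∧
      (F 1 2 3 2) = true ∧ (F 1 3 2 2) = true ∧ (F 2 1 1 2) = true ∧ (F 2 1 2 1) = true ∧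
      (F 2 1 2 3) = true ∧ (F 2 1 3 2) = true ∧ (F 2 2 1 1) = true ∧ (F 2 2 1 3) = true ∧
      (F 2 2 3 1) = true ∧ (F 2 2 3 3) = true ∧ (F 2 3 1 2) = true ∧ (F 2 3 2 1) = true ∧
      (F 2 3 2 3) = true ∧ (F 2 3 3 2) = true ∧ (F 3 1 2 2) = true ∧ (F 3 2 1 2) = true ∧
      (F 3 2 2 1) = true ∧ (F 3 2 2 3) = true ∧ (F 3 2 3 2) = true ∧ (F 3 3 2 2) = true := by
    clear hs0 hs1 hs3 hsab
    have h0 := hle 1 1 2 2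
    have h1 := hle 1 2 1 2
    have h2 := hle 1 2 2 1
    have h3 := hle 1 2 2 3
    have h4 := hle 1 2 3 2
    have h5 := hle 1 3 2 2
    have h6 := hle 2 1 1 2
    have h7 := hle 2 1 2 1
    have h8 := hle 2 1 2 3
    have h9 := hle 2 1 3 2
    have h10 := hle 2 2 1 1
    have h11 := hle 2 2 1 3
    have h12 := hle 2 2 3 1
    have h13 := hle 2 2 3 3
    have h14 := hle 2 3 1 2
    have h15 := hle 2 3 2 1
    have h16 := hle 2 3 2 3
    have h17 := hle 2 3 3 2
    have h18 := hle 3 1 2 2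
    have h19 := hle 3 2 1 2
    have h20 := hle 3 2 2 1
    have h21 := hle 3 2 2 3
    have h22 := hle 3 2 3 2
    have h23 := hle 3 3 2 2
    refine ⟨eq_true_of_pos ?_, eq_true_of_pos ?_, eq_true_of_pos ?_, eq_true_of_pos ?_,
      eq_true_of_pos ?_, eq_true_of_pos ?_, eq_true_of_pos ?_, eq_true_of_pos ?_,
      eq_true_of_pos ?_, eq_true_of_pos ?_, eq_true_of_pos ?_, eq_true_of_pos ?_,
      eq_true_of_pos ?_, eq_true_of_pos ?_, eq_true_of_pos ?_, eq_true_of_pos ?_,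
      eq_true_of_pos ?_, eq_true_of_pos ?_, eq_true_of_pos ?_, eq_true_of_pos ?_,
      eq_true_of_pos ?_, eq_true_of_pos ?_, eq_true_of_pos ?_, eq_true_of_pos ?_⟩ <;> omega
  obtain ⟨hc1122, hc1212, hc1221, hc1223, hc1232, hc1322, hc2112, hc2121,
    hc2123, hc2132, hc2211, hc2213, hc2231, hc2233, hc2312, hc2321,
    hc2323, hc2332, hc3122, hc3212, hc3221, hc3223, hc3232, hc3322⟩ := hC
  have hd : s3 = 0 := by
    have h0 := drop_ends hc1122 hc1322
      (hF 1 1 2 2 1 2 2 2 1 3 2 2 (by decide) (by decide))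
    have h1 := drop_ends hc1122 hc3122
      (hF 1 1 2 2 2 1 2 2 3 1 2 2 (by decide) (by decide))
    have h2 := drop_ends hc1212 hc3212
      (hF 1 2 1 2 2 2 1 2 3 2 1 2 (by decide) (by decide))
    have h3 := drop_ends hc1221 hc3221
      (hF 1 2 2 1 2 2 2 1 3 2 2 1 (by decide) (by decide))
    have h4 := drop_ends hc1223 hc3223
      (hF 1 2 2 3 2 2 2 3 3 2 2 3 (by decide) (by decide))
    have h5 := drop_ends hc1232 hc3232
      (hF 1 2 3 2 2 2 3 2 3 2 3 2 (by decide) (by decide))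
    have h6 := drop_ends hc1322 hc3322
      (hF 1 3 2 2 2 3 2 2 3 3 2 2 (by decide) (by decide))
    have h7 := drop_ends hc3122 hc3322
      (hF 3 1 2 2 3 2 2 2 3 3 2 2 (by decide) (by decide))
    clear hs0 hs1 hs2
    omega
  have ha := coreA
    (F 1 1 1 1)
    (F 1 1 1 3)
    (F 1 1 3 1)
    (drop_mid hc1122 (hF 1 1 1 3 1 1 2 2 1 1 3 1 (by decide) (by decide)))
    (F 1 1 3 3)
    (drop_mid hc1122 (hF 1 1 1 1 1 1 2 2 1 1 3 3 (by decide) (by decide)))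
    (F 1 3 1 1)
    (drop_mid hc1212 (hF 1 1 1 3 1 2 1 2 1 3 1 1 (by decide) (by decide)))
    (drop_mid hc1221 (hF 1 1 3 1 1 2 2 1 1 3 1 1 (by decide) (by decide)))
    (F 1 3 1 3)
    (drop_mid hc1212 (hF 1 1 1 1 1 2 1 2 1 3 1 3 (by decide) (by decide)))
    (drop_mid hc1223 (hF 1 1 3 3 1 2 2 3 1 3 1 3 (by decide) (by decide)))
    (F 1 3 3 1)
    (drop_mid hc1221 (hF 1 1 1 1 1 2 2 1 1 3 3 1 (by decide) (by decide)))
    (drop_mid hc1232 (hF 1 1 3 3 1 2 3 2 1 3 3 1 (by decide) (by decide)))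
    (drop_mid hc1322 (hF 1 3 1 3 1 3 2 2 1 3 3 1 (by decide) (by decide)))
    (F 1 3 3 3)
    (drop_mid hc1223 (hF 1 1 1 3 1 2 2 3 1 3 3 3 (by decide) (by decide)))
    (drop_mid hc1232 (hF 1 1 3 1 1 2 3 2 1 3 3 3 (by decide) (by decide)))
    (drop_mid hc1322 (hF 1 3 1 1 1 3 2 2 1 3 3 3 (by decide) (by decide)))
    (F 3 1 1 1)
    (drop_mid hc2112 (hF 1 1 1 3 2 1 1 2 3 1 1 1 (by decide) (by decide)))
    (drop_mid hc2121 (hF 1 1 3 1 2 1 2 1 3 1 1 1 (by decide) (by decide)))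
    (drop_mid hc2211 (hF 1 3 1 1 2 2 1 1 3 1 1 1 (by decide) (by decide)))
    (F 3 1 1 3)
    (drop_mid hc2112 (hF 1 1 1 1 2 1 1 2 3 1 1 3 (by decide) (by decide)))
    (drop_mid hc2123 (hF 1 1 3 3 2 1 2 3 3 1 1 3 (by decide) (by decide)))
    (drop_mid hc2213 (hF 1 3 1 3 2 2 1 3 3 1 1 3 (by decide) (by decide)))
    (F 3 1 3 1)
    (drop_mid hc2121 (hF 1 1 1 1 2 1 2 1 3 1 3 1 (by decide) (by decide)))
    (drop_mid hc2132 (hF 1 1 3 3 2 1 3 2 3 1 3 1 (by decide) (by decide)))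
    (drop_mid hc2231 (hF 1 3 3 1 2 2 3 1 3 1 3 1 (by decide) (by decide)))
    (drop_mid hc3122 (hF 3 1 1 3 3 1 2 2 3 1 3 1 (by decide) (by decide)))
    (F 3 1 3 3)
    (drop_mid hc2123 (hF 1 1 1 3 2 1 2 3 3 1 3 3 (by decide) (by decide)))
    (drop_mid hc2132 (hF 1 1 3 1 2 1 3 2 3 1 3 3 (by decide) (by decide)))
    (drop_mid hc2233 (hF 1 3 3 3 2 2 3 3 3 1 3 3 (by decide) (by decide)))
    (drop_mid hc3122 (hF 3 1 1 1 3 1 2 2 3 1 3 3 (by decide) (by decide)))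
    (F 3 3 1 1)
    (drop_mid hc2211 (hF 1 1 1 1 2 2 1 1 3 3 1 1 (by decide) (by decide)))
    (drop_mid hc2312 (hF 1 3 1 3 2 3 1 2 3 3 1 1 (by decide) (by decide)))
    (drop_mid hc2321 (hF 1 3 3 1 2 3 2 1 3 3 1 1 (by decide) (by decide)))
    (drop_mid hc3212 (hF 3 1 1 3 3 2 1 2 3 3 1 1 (by decide) (by decide)))
    (drop_mid hc3221 (hF 3 1 3 1 3 2 2 1 3 3 1 1 (by decide) (by decide)))
    (F 3 3 1 3)
    (drop_mid hc2213 (hF 1 1 1 3 2 2 1 3 3 3 1 3 (by decide) (by decide)))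
    (drop_mid hc2312 (hF 1 3 1 1 2 3 1 2 3 3 1 3 (by decide) (by decide)))
    (drop_mid hc2323 (hF 1 3 3 3 2 3 2 3 3 3 1 3 (by decide) (by decide)))
    (drop_mid hc3212 (hF 3 1 1 1 3 2 1 2 3 3 1 3 (by decide) (by decide)))
    (drop_mid hc3223 (hF 3 1 3 3 3 2 2 3 3 3 1 3 (by decide) (by decide)))
    (F 3 3 3 1)
    (drop_mid hc2231 (hF 1 1 3 1 2 2 3 1 3 3 3 1 (by decide) (by decide)))
    (drop_mid hc2321 (hF 1 3 1 1 2 3 2 1 3 3 3 1 (by decide) (by decide)))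
    (drop_mid hc2332 (hF 1 3 3 3 2 3 3 2 3 3 3 1 (by decide) (by decide)))
    (drop_mid hc3221 (hF 3 1 1 1 3 2 2 1 3 3 3 1 (by decide) (by decide)))
    (drop_mid hc3232 (hF 3 1 3 3 3 2 3 2 3 3 3 1 (by decide) (by decide)))
    (drop_mid hc3322 (hF 3 3 1 3 3 3 2 2 3 3 3 1 (by decide) (by decide)))
    (F 3 3 3 3)
    (drop_mid hc2233 (hF 1 1 3 3 2 2 3 3 3 3 3 3 (by decide) (by decide)))
    (drop_mid hc2323 (hF 1 3 1 3 2 3 2 3 3 3 3 3 (by decide) (by decide)))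
    (drop_mid hc2332 (hF 1 3 3 1 2 3 3 2 3 3 3 3 (by decide) (by decide)))
    (drop_mid hc3223 (hF 3 1 1 3 3 2 2 3 3 3 3 3 (by decide) (by decide)))
    (drop_mid hc3232 (hF 3 1 3 1 3 2 3 2 3 3 3 3 (by decide) (by decide)))
    (drop_mid hc3322 (hF 3 3 1 1 3 3 2 2 3 3 3 3 (by decide) (by decide)))
  have e0 := edgeSum_le hF (by
    rintro y z (rfl | rfl) (rfl | rfl) <;> exact ⟨by assumption, by assumption, by assumption⟩)
  have e1 := edgeSum_le hF.swap1 (by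
    rintro y z (rfl | rfl) (rfl | rfl) <;> exact ⟨by assumption, by assumption, by assumption⟩)
  have e2 := edgeSum_le hF.swap2 (by
    rintro y z (rfl | rfl) (rfl | rfl) <;> exact ⟨by assumption, by assumption, by assumption⟩)
  have e3 := edgeSum_le hF.swap3 (by
    rintro y z (rfl | rfl) (rfl | rfl) <;> exact ⟨by assumption, by assumption, by assumption⟩)
  simp only [edgeSum, blocked] at e0 e1 e2 e3
  rw [← hs0] at ha
  clear hs0 hs2 hs3 hle
  omega

/-! ### From sets to indicator functions -/

theorem card_eq_sum (A : Finset (Fin 4 → ℤ)) (hA : A ⊆ cube 4) :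
    A.card = ∑ a ∈ ({1, 2, 3} : Finset ℤ), ∑ b ∈ ({1, 2, 3} : Finset ℤ),
      ∑ c ∈ ({1, 2, 3} : Finset ℤ), ∑ d ∈ ({1, 2, 3} : Finset ℤ),
        (decide (![a, b, c, d] ∈ A)).toNat := by
  let S : Finset ℤ := {1, 2, 3}
  have h1 : A.card = ((S ×ˢ S ×ˢ S ×ˢ S).filter
      (fun p => ![p.1, p.2.1, p.2.2.1, p.2.2.2] ∈ A)).card := by
    symm
    refine Finset.card_bij (fun p _ => ![p.1, p.2.1, p.2.2.1, p.2.2.2]) ?_ ?_ ?_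
    · intro p hp
      exact (Finset.mem_filter.1 hp).2
    · rintro ⟨a, b, c, d⟩ _ ⟨a', b', c', d'⟩ _ h
      have h0 := congrFun h 0
      have h1 := congrFun h 1
      have h2 := congrFun h 2
      have h3 := congrFun h 3
      simp at h0 h1 h2 h3
      simp [h0, h1, h2, h3]
    · intro x hx
      have hx' := Fintype.mem_piFinset.1 (hA hx)
      have hxe : ![x 0, x 1, x 2, x 3] = x := by
        ext i; fin_cases i <;> rfl
      refine ⟨(x 0, x 1, x 2, x 3), ?_, hxe⟩
      simp only [Finset.mem_filter, Finset.mem_product]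
      exact ⟨⟨hx' 0, hx' 1, hx' 2, hx' 3⟩, by rw [hxe]; exact hx⟩
  rw [h1, Finset.card_filter]
  simp only [Finset.sum_product]
  refine Finset.sum_congr rfl fun a _ => Finset.sum_congr rfl fun b _ =>
    Finset.sum_congr rfl fun c _ => Finset.sum_congr rfl fun d _ => ?_
  by_cases h : ![a, b, c, d] ∈ A <;> simp [h]

theorem noLine4_of_moserFree {A : Finset (Fin 4 → ℤ)} (hA : MoserFree A) :
    NoLine4 (fun a b c d => decide (![a, b, c, d] ∈ A)) := by
  intro a b c d a' b' c' d' a'' b'' c'' d'' hne h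
  obtain ⟨h0, h1, h2, h3⟩ := h
  rw [Bool.eq_false_iff]
  intro hall
  simp only [Bool.and_eq_true, decide_eq_true_eq] at hall
  obtain ⟨⟨hx, hy⟩, hz⟩ := hall
  have e1 : ![a, b, c, d] + ![a' - a, b' - b, c' - c, d' - d] = ![a', b', c', d'] := by
    ext i; fin_cases i <;> simp
  have e2 : ![a', b', c', d'] + ![a' - a, b' - b, c' - c, d' - d] = ![a'', b'', c'', d''] := by
    ext i; fin_cases i <;> simp <;> omega
  refine hA ⟨![a, b, c, d], ![a' - a, b' - b, c' - c, d' - d], ?_, hx, ?_, ?_⟩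
  · intro hr
    have r0 := congrFun hr 0
    have r1 := congrFun hr 1
    have r2 := congrFun hr 2
    have r3 := congrFun hr 3
    simp at r0 r1 r2 r3
    omega
  · rw [e1]; exact hy
  · rw [e1, e2]; exact hz

/-! ### The extremal example, of statistics `(3, 16, 24, 0, 0)` -/

/-- Number of coordinates equal to two. -/
def twos (a b c d : ℤ) : ℕ :=
  (decide (a = 2)).toNat + (decide (b = 2)).toNat + (decide (c = 2)).toNat + (decide (d = 2)).toNat

/-- Indicator function of the example. -/
def good (a b c d : ℤ) : Bool :=
  twos a b c d == 2 || (twos a b c d == 1 && (a + b + c + d) % 4 == 3) ||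
  (b == 1 && c == 1 && d == 1 && (a == 1 || a == 3)) || (a == 3 && b == 3 && c == 3 && d == 3)

/-- The example of cardinality 43. -/
def example43 : Finset (Fin 4 → ℤ) :=
  (cube 4).filter fun x => good (x 0) (x 1) (x 2) (x 3) = true

/-- Start and step of the one-dimensional progressions. -/
def steps : List (ℤ × ℤ) := [(1, 0), (2, 0), (3, 0), (1, 1), (3, -1)]

theorem mem_steps {a r : ℤ} (h0 : a ∈ ({1, 2, 3} : Finset ℤ)) (h1 : a + r ∈ ({1, 2, 3} : Finset ℤ))
    (h2 : a + r + r ∈ ({1, 2, 3} : Finset ℤ)) : (a, r) ∈ steps := by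
  simp only [Finset.mem_insert, Finset.mem_singleton] at h0 h1 h2
  simp only [steps, List.mem_cons, Prod.mk.injEq, List.not_mem_nil, or_false]
  omega

theorem good_noLine : ∀ p ∈ steps, ∀ q ∈ steps, ∀ s ∈ steps, ∀ t ∈ steps,
    good p.1 q.1 s.1 t.1 = true →
    good (p.1 + p.2) (q.1 + q.2) (s.1 + s.2) (t.1 + t.2) = true →
    good (p.1 + p.2 + p.2) (q.1 + q.2 + q.2) (s.1 + s.2 + s.2) (t.1 + t.2 + t.2) = true →
    p.2 = 0 ∧ q.2 = 0 ∧ s.2 = 0 ∧ t.2 = 0 := by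
  decide +kernel

theorem example43_free : MoserFree example43 := by
  rintro ⟨a, r, hr, h0, h1, h2⟩
  simp only [example43, Finset.mem_filter, cube, Fintype.mem_piFinset] at h0 h1 h2
  have hs := fun i => mem_steps (h0.1 i) (h1.1 i) (h2.1 i)
  obtain ⟨r0, r1, r2, r3⟩ := good_noLine _ (hs 0) _ (hs 1) _ (hs 2) _ (hs 3) h0.2 h1.2 h2.2
  apply hr
  ext i
  fin_cases i
  · exact r0
  · exact r1
  · exact r2
  · exact r3

theorem example43_card : example43.card = 43 := by
  rw [card_eq_sum example43 (Finset.filter_subset _ _)]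
  have h : ∀ a ∈ ({1, 2, 3} : Finset ℤ), ∀ b ∈ ({1, 2, 3} : Finset ℤ),
      ∀ c ∈ ({1, 2, 3} : Finset ℤ), ∀ d ∈ ({1, 2, 3} : Finset ℤ),
      (decide (![a, b, c, d] ∈ example43)).toNat = (good a b c d).toNat := by
    intro a ha b hb c hc d hd
    have : ![a, b, c, d] ∈ cube 4 := by
      rw [cube, Fintype.mem_piFinset]
      intro i
      fin_cases i
      · exact ha
      · exact hb
      · exact hc
      · exact hd
    simp [example43, this]
  rw [Finset.sum_congr rfl fun a ha => Finset.sum_congr rfl fun b hb =>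
    Finset.sum_congr rfl fun c hc => Finset.sum_congr rfl fun d hd => h a ha b hb c hc d hd]
  decide +kernel

/-- `c'_{4,3} = 43`. -/
theorem moser_4_eq_fortythree :
    IsGreatest {m | ∃ A : Finset (Fin 4 → ℤ), A ⊆ cube 4 ∧ MoserFree A ∧ A.card = m}
      43 := by
  constructor
  · exact ⟨example43, Finset.filter_subset _ _, example43_free, example43_card⟩
  · rintro m ⟨A, hA, hfree, rfl⟩
    rw [card_eq_sum A hA]
    exact upper4 (noLine4_of_moserFree hfree)
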